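/- arXiv:1010.1872 — 6 statements merged into one kernel-verified Lean document; each statement's English description precedes it below -/
import Mathlib

section
/- Let (A, B, s) and (A', B', s') be configurations such that the universes of A and A' are finite, B is generated by the image s(A), and B' is generated by the image s'(A'). Suppose there exist embeddings μ₁ : A → A', ν₁ : B → B' with ν₁ ∘ s = s' ∘ μ₁ and embeddings μ₂ : A' → A, ν₂ : B' → B with ν₂ ∘ s' = s ∘ μ₂. Then every pair of embeddings μ : A → A', ν : B → B' with ν ∘ s = s' ∘ μ consists of bijections, and hence A is isomorphic to A' and B is isomorphic to B' via maps making the square commute. -/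
open FirstOrder FirstOrder.Language

/-- If two configurations `(A, B, s)` and `(A', B', s')` (with finite index structures and
element structures generated by the images of `s`, `s'`) embed into each other, then every
commuting pair of embeddings between them is a pair of bijections, and the configurations
are isomorphic via maps making the square commute. -/
theorem equivalent_configurations_isomorphic
    {σI σE : FirstOrder.Language} {A A' B B' : Type*}
    [σI.Structure A] [σI.Structure A'] [σE.Structure B] [σE.Structure B']
    [Finite A] [Finite A']
    (s : A → B) (s' : A' → B')
    (hgen : Substructure.closure σE (Set.range s) = ⊤)
    (hgen' : Substructure.closure σE (Set.range s') = ⊤)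
    (μ₁ : A ↪[σI] A') (ν₁ : B ↪[σE] B') (hcomm₁ : ∀ x, ν₁ (s x) = s' (μ₁ x))
    (μ₂ : A' ↪[σI] A) (ν₂ : B' ↪[σE] B) (hcomm₂ : ∀ x, ν₂ (s' x) = s (μ₂ x)) :
    (∀ (μ : A ↪[σI] A') (ν : B ↪[σE] B'), (∀ x, ν (s x) = s' (μ x)) →
      Function.Bijective μ ∧ Function.Bijective ν) ∧
    (∃ (g : A ≃[σI] A') (h : B ≃[σE] B'), ∀ x, h (s x) = s' (g x)) := by
  have key : ∀ (μ : A ↪[σI] A') (ν : B ↪[σE] B'), (∀ x, ν (s x) = s' (μ x)) →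
      Function.Bijective μ ∧ Function.Bijective ν := by
    intro μ ν h
    have hμ : Function.Surjective μ :=
      (Finite.surjective_of_injective (μ.injective.comp μ₂.injective)).of_comp
    refine ⟨⟨μ.injective, hμ⟩, ν.injective, ?_⟩
    have hle : Substructure.closure σE (Set.range s') ≤ ν.toHom.range := by
      rw [Substructure.closure_le]
      rintro _ ⟨a', rfl⟩
      obtain ⟨a, rfl⟩ := hμ a'
      exact ⟨s a, h a⟩
    intro b
    have hb : b ∈ Substructure.closure σE (Set.range s') := by
      rw [hgen']; trivial
    exact hle hb
  refine ⟨key, ?_⟩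
  obtain ⟨h1, h2⟩ := key μ₁ ν₁ hcomm₁
  refine ⟨{ toEquiv := _root_.Equiv.ofBijective μ₁ h1
            map_fun' := fun f x => μ₁.map_fun f x
            map_rel' := fun r x => μ₁.map_rel r x },
          { toEquiv := _root_.Equiv.ofBijective ν₁ h2
            map_fun' := fun f x => ν₁.map_fun f x
            map_rel' := fun r x => ν₁.map_rel r x }, fun x => hcomm₁ x⟩
end

section
/- (Robinson Diagram Lemma.) Let L be a first-order language, M an L-structure generated by a subset G ⊆ M, and N an L-structure. Then the map sending an L-embedding μ : M → N to its restriction μ|_G is a bijection between the set of L-embeddings from M to N and the set of functions a : G → N such that for every n, every n-tuple ḡ of elements of G, and every literal φ in n free variables, if φ holds in M of ḡ then φ holds in N of a ∘ ḡ. -/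
open FirstOrder FirstOrder.Language

/-- A literal is an atomic formula or the negation of an atomic formula. -/
def IsLiteral {L : FirstOrder.Language} {α : Type*} (φ : L.Formula α) : Prop :=
  BoundedFormula.IsAtomic φ ∨
    ∃ ψ : L.Formula α, BoundedFormula.IsAtomic ψ ∧ φ = ψ.not

/-- `a : G → N` satisfies the diagram of `M` relative to `G`: every literal true in `M`
of a tuple from `G` is true in `N` of the corresponding `a`-tuple. -/
def SatisfiesDiagram (L : FirstOrder.Language) {M N : Type*}
    [L.Structure M] [L.Structure N] (G : Set M) (a : G → N) : Prop :=
  ∀ (n : ℕ) (φ : L.Formula (Fin n)), IsLiteral φ → ∀ g : Fin n → G,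
    φ.Realize (fun i => (g i : M)) → φ.Realize (fun i => a (g i))

/-- Finitely many terms over `G` only use finitely many variables. -/
theorem exists_fin_terms {L : FirstOrder.Language} {α : Type*} {k : ℕ} (ts : Fin k → L.Term α) :
    ∃ (n : ℕ) (g : Fin n → α) (ts' : Fin k → L.Term (Fin n)),
      ∀ i, (ts' i).relabel g = ts i := by
  classical
  let S : Finset α := Finset.univ.biUnion fun i => (ts i).varFinset
  have key : ∀ t : L.Term α, t.varFinset ⊆ S →
      ∃ t' : L.Term (Fin S.card), t'.relabel (fun j => (S.equivFin.symm j : α)) = t := by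
    intro t
    induction t with
    | var x =>
      intro h
      have hx : x ∈ S := h (by simp [Term.varFinset])
      exact ⟨Term.var (S.equivFin ⟨x, hx⟩), by simp [Term.relabel]⟩
    | func f us ih =>
      intro h
      have h2 : ∀ i, (us i).varFinset ⊆ S := fun i =>
        (Finset.subset_biUnion_of_mem (fun i => (us i).varFinset) (Finset.mem_univ i)).trans h
      choose us' hus using fun i => ih i (h2 i)
      exact ⟨Term.func f us', by simp [Term.relabel, hus]⟩
  choose ts' hts using fun i => key (ts i)
    (Finset.subset_biUnion_of_mem (fun i => (ts i).varFinset) (Finset.mem_univ i))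
  exact ⟨S.card, _, ts', hts⟩

theorem SatisfiesDiagram.iff {L : FirstOrder.Language} {M N : Type*}
    [L.Structure M] [L.Structure N] {G : Set M} {a : G → N} (h : SatisfiesDiagram L G a)
    {n : ℕ} (φ : L.Formula (Fin n)) (hφ : BoundedFormula.IsAtomic φ) (g : Fin n → G) :
    φ.Realize (fun i => (g i : M)) ↔ φ.Realize (fun i => a (g i)) := by
  refine ⟨h n φ (Or.inl hφ) g, fun hN => ?_⟩
  by_contra hM
  have := h n φ.not (Or.inr ⟨φ, hφ, rfl⟩) g (by rwa [Formula.realize_not])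
  rw [Formula.realize_not] at this
  exact this hN

theorem SatisfiesDiagram.rel_iff {L : FirstOrder.Language} {M N : Type*}
    [L.Structure M] [L.Structure N] {G : Set M} {a : G → N} (h : SatisfiesDiagram L G a)
    {k : ℕ} (R : L.Relations k) (ts : Fin k → L.Term G) :
    Structure.RelMap R (fun i => (ts i).realize (Subtype.val : G → M)) ↔
      Structure.RelMap R (fun i => (ts i).realize a) := by
  obtain ⟨n, g, ts', hts⟩ := exists_fin_terms ts
  have := h.iff (R.formula ts') (BoundedFormula.IsAtomic.rel _ _) g
  rw [Formula.realize_rel, Formula.realize_rel] at this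
  simp only [← hts, Term.realize_relabel]
  exact this

theorem SatisfiesDiagram.eq_iff {L : FirstOrder.Language} {M N : Type*}
    [L.Structure M] [L.Structure N] {G : Set M} {a : G → N} (h : SatisfiesDiagram L G a)
    (t₁ t₂ : L.Term G) :
    t₁.realize (Subtype.val : G → M) = t₂.realize (Subtype.val : G → M) ↔
      t₁.realize a = t₂.realize a := by
  obtain ⟨n, g, ts', hts⟩ := exists_fin_terms ![t₁, t₂]
  have := h.iff ((ts' 0).equal (ts' 1)) (BoundedFormula.IsAtomic.equal _ _) g
  rw [Formula.realize_equal, Formula.realize_equal] at this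
  have h0 : (ts' 0).relabel g = t₁ := hts 0
  have h1 : (ts' 1).relabel g = t₂ := hts 1
  simp only [← h0, ← h1, Term.realize_relabel]
  exact this

/-- Robinson Diagram Lemma: for `M` generated by `G`, restriction to `G` is a bijection
between embeddings `M ↪[L] N` and maps `G → N` satisfying the diagram of `M`. -/
theorem robinson_diagram_lemma {L : FirstOrder.Language} {M N : Type*}
    [L.Structure M] [L.Structure N] (G : Set M)
    (hgen : Substructure.closure L G = ⊤) :
    (∀ μ : M ↪[L] N, SatisfiesDiagram L G (fun g : G => μ g)) ∧
    (∀ a : G → N, SatisfiesDiagram L G a →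
      ∃! μ : M ↪[L] N, ∀ g : G, μ g = a g) := by
  refine ⟨?_, ?_⟩
  · rintro μ n φ hφ g hr
    have key : ∀ ψ : L.Formula (Fin n), BoundedFormula.IsAtomic ψ →
        (ψ.Realize (fun i => μ (g i : M)) ↔ ψ.Realize (fun i => (g i : M))) := by
      intro ψ hψ
      cases hψ with
      | equal t₁ t₂ =>
        have e : ∀ t : L.Term (Fin n ⊕ Fin 0), t.realize
            (Sum.elim (fun i => μ (g i : M)) (default : Fin 0 → N)) =
            μ (t.realize (Sum.elim (fun i => (g i : M)) (default : Fin 0 → M))) := by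
          intro t
          rw [← HomClass.realize_term]
          congr 1
          funext x
          rcases x with x | x
          · rfl
          · exact x.elim0
        simp only [Formula.Realize, BoundedFormula.realize_bdEqual, e]
        exact μ.injective.eq_iff
      | rel R ts =>
        have e : ∀ t : L.Term (Fin n ⊕ Fin 0), t.realize
            (Sum.elim (fun i => μ (g i : M)) (default : Fin 0 → N)) =
            μ (t.realize (Sum.elim (fun i => (g i : M)) (default : Fin 0 → M))) := by
          intro t
          rw [← HomClass.realize_term]
          congr 1
          funext x
          rcases x with x | x
          · rfl
          · exact x.elim0
        simp only [Formula.Realize, BoundedFormula.realize_rel, e]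
        exact μ.map_rel R _
    rcases hφ with hφ | ⟨ψ, hψ, rfl⟩
    · exact (key φ hφ).2 hr
    · rw [Formula.realize_not] at hr ⊢
      exact fun hc => hr ((key ψ hψ).1 hc)
  · intro a h
    have hs : ∀ x : M, ∃ t : L.Term G, t.realize (Subtype.val : G → M) = x := fun x =>
      Substructure.mem_closure_iff_exists_term.1 (hgen ▸ Substructure.mem_top x)
    choose t ht using hs
    let μ : M ↪[L] N :=
      { toFun := fun x => (t x).realize a
        inj' := fun x y hxy => by
          have := (h.eq_iff (t x) (t y)).2 hxy
          rwa [ht, ht] at this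
        map_fun' := fun f x => by
          have := (h.eq_iff (t (Structure.funMap f x)) (Term.func f fun i => t (x i))).1
            (by simp [ht])
          rw [this]
          rfl
        map_rel' := fun R x => by
          have := h.rel_iff R fun i => t (x i)
          simp only [ht] at this
          exact this.symm }
    refine ⟨μ, fun g => ?_, fun ν hν => ?_⟩
    · exact (h.eq_iff (t g) (Term.var g)).1 (by simp [ht])
    · ext x
      have e : ν x = (t x).realize a := by
        conv_lhs => rw [← ht x]
        rw [← HomClass.realize_term]
        congr 1
        funext g
        exact hν g
      exact e
end

section
/- Let L be a first-order language with finitely many function symbols and finitely many relation symbols, let M be an L-structure with finite universe, and let G ⊆ M generate M. Then there exist finitely many literals with free variables indexed by G, each true in M under the assignment sending the variable indexed by g to g, such that for every L-structure N and every assignment a : G → N satisfying all of these finitely many literals, N under a satisfies every literal (with free variables indexed by G) that is true in M under the canonical assignment. -/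
open FirstOrder FirstOrder.Language

/-- For a finite structure `M` over a finite language, generated by `G`, there are finitely
many literals (in variables indexed by `G`, true in `M` under the canonical assignment)
such that any assignment in any structure satisfying them satisfies every literal of the
diagram of `M`. -/
theorem finite_diagram {L : FirstOrder.Language}
    [Finite (Σ n, L.Functions n)] [Finite (Σ n, L.Relations n)]
    {M : Type*} [L.Structure M] [Finite M] (G : Set M)
    (hgen : Substructure.closure L G = ⊤) :
    ∃ S : Set (L.Formula G), S.Finite ∧
      (∀ φ ∈ S, IsLiteral φ ∧ φ.Realize ((↑) : G → M)) ∧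
      (∀ (N : Type*) (_ : L.Structure N) (a : G → N),
        (∀ φ ∈ S, φ.Realize a) →
        ∀ φ : L.Formula G, IsLiteral φ → φ.Realize ((↑) : G → M) → φ.Realize a) := by
  classical
  have ht : ∀ m : M, ∃ t : L.Term (G ⊕ Fin 0),
      t.realize (Sum.elim ((↑) : G → M) default) = m := by
    intro m
    have hm : m ∈ Substructure.closure L G := by rw [hgen]; trivial
    obtain ⟨t, h⟩ := Substructure.mem_closure_iff_exists_term.1 hm
    refine ⟨t.relabel Sum.inl, ?_⟩
    rw [Term.realize_relabel]
    exact h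
  choose t ht using ht
  let A1 : G → L.Formula G := fun g =>
    Term.bdEqual (n := 0) (Term.var (Sum.inl g)) (t g)
  let A2 : (Σ f : (Σ n, L.Functions n), (Fin f.1 → M)) → L.Formula G := fun p =>
    Term.bdEqual (n := 0) (Term.func p.1.2 (fun i => t (p.2 i)))
      (t (Structure.funMap p.1.2 p.2))
  let A3 : M × M → L.Formula G := fun p => Term.bdEqual (n := 0) (t p.1) (t p.2)
  let A4 : (Σ f : (Σ n, L.Relations n), (Fin f.1 → M)) → L.Formula G := fun p =>
    Relations.boundedFormula p.1.2 (fun i => t (p.2 i))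
  let A : G ⊕ (Σ f : (Σ n, L.Functions n), (Fin f.1 → M)) ⊕ (M × M) ⊕
      (Σ f : (Σ n, L.Relations n), (Fin f.1 → M)) → L.Formula G :=
    Sum.elim A1 (Sum.elim A2 (Sum.elim A3 A4))
  have hA : ∀ i, BoundedFormula.IsAtomic (A i) := by
    rintro (i | i | i | i)
    · exact .equal _ _
    · exact .equal _ _
    · exact .equal _ _
    · exact .rel _ _
  let lit : L.Formula G → L.Formula G := fun ψ =>
    if ψ.Realize ((↑) : G → M) then ψ else ψ.not
  refine ⟨Set.range (fun i => lit (A i)), Set.finite_range _, ?_, ?_⟩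
  · rintro _ ⟨i, rfl⟩
    by_cases h : (A i).Realize ((↑) : G → M)
    · simp only [lit, if_pos h]
      exact ⟨Or.inl (hA i), h⟩
    · simp only [lit, if_neg h]
      exact ⟨Or.inr ⟨_, hA i, rfl⟩, Formula.realize_not.2 h⟩
  intro N _ a ha
  have key : ∀ i, (A i).Realize a ↔ (A i).Realize ((↑) : G → M) := by
    intro i
    have h1 := ha _ ⟨i, rfl⟩
    by_cases h : (A i).Realize ((↑) : G → M)
    · simp only [lit, if_pos h] at h1
      exact iff_of_true h1 h
    · simp only [lit, if_neg h] at h1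
      exact iff_of_false (Formula.realize_not.1 h1) h
  have k1 : ∀ g : G, a g = (t g).realize (Sum.elim a default) := by
    intro g
    have := key (Sum.inl g)
    simp only [A, A1, Sum.elim_inl, Formula.Realize, BoundedFormula.realize_bdEqual,
      Term.realize_var, ht] at this
    simpa using this
  have k2 : ∀ (n : ℕ) (f : L.Functions n) (x : Fin n → M),
      Structure.funMap f (fun i => (t (x i)).realize (Sum.elim a default)) =
        (t (Structure.funMap f x)).realize (Sum.elim a default) := by
    intro n f x
    have := key (Sum.inr (Sum.inl ⟨⟨n, f⟩, x⟩))
    simp only [A, A2, Sum.elim_inl, Sum.elim_inr, Formula.Realize,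
      BoundedFormula.realize_bdEqual, Term.realize_func, ht] at this
    simpa using this
  have k3 : ∀ m m' : M, (t m).realize (Sum.elim a default) =
      (t m').realize (Sum.elim a default) ↔ m = m' := by
    intro m m'
    have := key (Sum.inr (Sum.inr (Sum.inl (m, m'))))
    simpa only [A, A3, Sum.elim_inl, Sum.elim_inr, Formula.Realize,
      BoundedFormula.realize_bdEqual, ht] using this
  have k4 : ∀ (n : ℕ) (R : L.Relations n) (x : Fin n → M),
      Structure.RelMap R (fun i => (t (x i)).realize (Sum.elim a default)) ↔
        Structure.RelMap R x := by
    intro n R x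
    have := key (Sum.inr (Sum.inr (Sum.inr ⟨⟨n, R⟩, x⟩)))
    simpa only [A, A4, Sum.elim_inl, Sum.elim_inr, Formula.Realize,
      BoundedFormula.realize_rel, ht] using this
  have kt : ∀ s : L.Term (G ⊕ Fin 0), s.realize (Sum.elim a default) =
      (t (s.realize (Sum.elim ((↑) : G → M) default))).realize (Sum.elim a default) := by
    intro s
    induction s with
    | var v =>
      rcases v with g | i
      · exact k1 g
      · exact i.elim0
    | func f ts ih =>
      simp only [Term.realize_func]
      rw [← k2]
      congr 1
      funext i
      exact ih i
  have kat : ∀ ψ : L.Formula G, BoundedFormula.IsAtomic ψ →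
      (ψ.Realize a ↔ ψ.Realize ((↑) : G → M)) := by
    intro ψ hψ
    cases hψ with
    | equal s₁ s₂ =>
      simp only [Formula.Realize, BoundedFormula.realize_bdEqual]
      rw [kt s₁, kt s₂, k3]
    | rel R ts =>
      simp only [Formula.Realize, BoundedFormula.realize_rel]
      rw [← k4]
      simp only [← kt]
  rintro φ (h | ⟨ψ, h, rfl⟩) hM
  · exact (kat φ h).2 hM
  · rw [Formula.realize_not] at hM ⊢
    exact fun h' => hM ((kat ψ h).1 h')
end

section
/- Let (A, B, s) be a configuration such that the universe of A is finite, with elements a₁, …, aₙ (listing all elements of A), and such that B is generated by {s(a₁), …, s(aₙ)}. Then for every configuration (A', B', s'): (A, B, s) ≤ (A', B', s') if and only if there exist elements b₁, …, bₙ of A' such that (a) for every Σ_I-literal φ in k free variables and all indices i₁, …, i_k ∈ {1, …, n}, if φ holds in A of (a_{i₁}, …, a_{i_k}) then φ holds in A' of (b_{i₁}, …, b_{i_k}), and (b) for every Σ_E-literal ψ in k free variables and all indices i₁, …, i_k ∈ {1, …, n}, if ψ holds in B of (s(a_{i₁}), …, s(a_{i_k})) then ψ holds in B' of (s'(b_{i₁}),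 …, s'(b_{i_k})). -/
open FirstOrder FirstOrder.Language

theorem literal_of_embedding {L : FirstOrder.Language} {M N : Type*} [L.Structure M]
    [L.Structure N] (f : M ↪[L] N) {k : ℕ} (φ : L.Formula (Fin k)) (h : IsLiteral φ)
    (v : Fin k → M) (hv : φ.Realize v) : φ.Realize (fun j => f (v j)) := by
  have key : ∀ ψ : L.Formula (Fin k), BoundedFormula.IsAtomic ψ →
      (ψ.Realize (fun j => f (v j)) ↔ ψ.Realize v) := by
    intro ψ hψ
    have hd : (Sum.elim (fun j => f (v j)) default : Fin k ⊕ Fin 0 → N)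
        = f ∘ Sum.elim v default := by
      funext x
      rcases x with x | x
      · rfl
      · exact x.elim0
    cases hψ with
    | equal t₁ t₂ =>
      simp only [Formula.Realize, BoundedFormula.realize_bdEqual]
      rw [hd, HomClass.realize_term, HomClass.realize_term]
      exact f.injective.eq_iff
    | rel R ts =>
      simp only [Formula.Realize, BoundedFormula.realize_rel]
      rw [hd]
      simp only [HomClass.realize_term]
      exact f.map_rel R _
  rcases h with h | ⟨ψ, h, rfl⟩
  · exact (key φ h).2 hv
  · rw [Formula.realize_not] at hv ⊢
    rwa [key ψ h]

theorem exists_embedding_of_literals {L : FirstOrder.Language} {M N : Type*} [L.Structure M]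
    [L.Structure N] {n : ℕ} (m : Fin n → M) (m' : Fin n → N)
    (hgen : Substructure.closure L (Set.range m) = ⊤)
    (h : ∀ φ : L.Formula (Fin n), IsLiteral φ → φ.Realize m → φ.Realize m') :
    ∃ f : M ↪[L] N, ∀ i, f (m i) = m' i := by
  have hatom : ∀ φ : L.Formula (Fin n), BoundedFormula.IsAtomic φ →
      (φ.Realize m ↔ φ.Realize m') := by
    intro φ hφ
    refine ⟨h φ (Or.inl hφ), fun h' => ?_⟩
    by_contra hn
    exact (Formula.realize_not.1 (h φ.not (Or.inr ⟨φ, hφ, rfl⟩) (Formula.realize_not.2 hn))) h'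
  have heq : ∀ t₁ t₂ : L.Term (Fin n),
      (t₁.realize m = t₂.realize m ↔ t₁.realize m' = t₂.realize m') := by
    intro t₁ t₂
    have := hatom (t₁.equal t₂) (BoundedFormula.IsAtomic.equal _ _)
    simpa only [Formula.realize_equal] using this
  have hrel : ∀ (k : ℕ) (R : L.Relations k) (ts : Fin k → L.Term (Fin n)),
      (Structure.RelMap R (fun i => (ts i).realize m) ↔
        Structure.RelMap R (fun i => (ts i).realize m')) := by
    intro k R ts
    have := hatom (R.formula ts) (BoundedFormula.IsAtomic.rel _ _)
    simpa only [Formula.realize_rel] using this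
  have hterm : ∀ x : M, ∃ t : L.Term (Fin n), t.realize m = x := by
    intro x
    refine Substructure.dense_induction (p := fun x => ∃ t : L.Term (Fin n), t.realize m = x)
      x hgen ?_ ?_
    · rintro _ ⟨i, rfl⟩
      exact ⟨Term.var i, rfl⟩
    · intro k f xs hxs
      choose ts hts using hxs
      refine ⟨Term.func f ts, ?_⟩
      rw [Term.realize_func]
      congr 1
      funext i
      exact hts i
  choose τ hτ using hterm
  refine ⟨⟨⟨fun x => (τ x).realize m', ?_⟩, ?_, ?_⟩, ?_⟩
  · intro x y hxy
    have := (heq _ _).2 hxy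
    rwa [hτ, hτ] at this
  · intro k f xs
    refine (heq (τ _) (Term.func f fun i => τ (xs i))).1 ?_
    rw [hτ, Term.realize_func]
    simp only [hτ]
  · intro k R xs
    have := hrel k R (fun i => τ (xs i))
    simp only [hτ] at this
    exact this.symm
  · intro i
    exact (heq (τ (m i)) (Term.var i)).1 (hτ _)

/-- For a configuration `(A, B, s)` with `A` finite (listed by `a : Fin n → A`) and `B`
generated by the image of the listing under `s`, the configuration preorder
`(A, B, s) ≤ (A', B', s')` is characterized by the existence of a tuple in `A'`
preserving all index literals and all element literals of the diagram. -/
theorem config_le_iff_diagram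
    {σI σE : FirstOrder.Language} {A B : Type*}
    [σI.Structure A] [σE.Structure B] (s : A → B)
    {n : ℕ} (a : Fin n → A) (hsurj : Function.Surjective a)
    (hgen : Substructure.closure σE (Set.range fun i => s (a i)) = ⊤)
    {A' B' : Type*} [σI.Structure A'] [σE.Structure B'] (s' : A' → B') :
    (∃ (μ : A ↪[σI] A') (ν : B ↪[σE] B'), ∀ x, ν (s x) = s' (μ x)) ↔
    ∃ b : Fin n → A',
      (∀ (k : ℕ) (φ : σI.Formula (Fin k)), IsLiteral φ → ∀ idx : Fin k → Fin n,
        φ.Realize (fun j => a (idx j)) → φ.Realize (fun j => b (idx j))) ∧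
      (∀ (k : ℕ) (ψ : σE.Formula (Fin k)), IsLiteral ψ → ∀ idx : Fin k → Fin n,
        ψ.Realize (fun j => s (a (idx j))) → ψ.Realize (fun j => s' (b (idx j)))) := by
  constructor
  · rintro ⟨μ, ν, hc⟩
    refine ⟨fun i => μ (a i), fun k φ hφ idx hv => literal_of_embedding μ φ hφ _ hv,
      fun k ψ hψ idx hv => ?_⟩
    have := literal_of_embedding ν ψ hψ _ hv
    simpa only [hc] using this
  · rintro ⟨b, hI, hE⟩
    obtain ⟨μ, hμ⟩ := exists_embedding_of_literals a b
      (by rw [hsurj.range_eq, Substructure.closure_univ]) (fun φ hφ => hI n φ hφ id)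
    obtain ⟨ν, hν⟩ := exists_embedding_of_literals (fun i => s (a i)) (fun i => s' (b i))
      hgen (fun φ hφ => hE n φ hφ id)
    refine ⟨μ, ν, fun x => ?_⟩
    obtain ⟨i, rfl⟩ := hsurj x
    rw [hμ]
    exact hν i
end

section
/- Consider a transition system with states S, transition relation τ, initial states I, and unsafe states U. Fix k ∈ ℕ and let B = ⋃_{i=0}^{k} Pre^i(U). If Pre^{k+1}(U) ⊆ B and I ∩ Pre^i(U) = ∅ for every i ≤ k, then the complement J = S \ B satisfies: (i) I ⊆ J; (ii) for all s, s', if s ∈ J and τ s s' then s' ∈ J; (iii) J ∩ U = ∅. -/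
/-- Pre-image of a set of states under a transition relation. -/
def Pre {S : Type*} (τ : S → S → Prop) (X : Set S) : Set S :=
  {s | ∃ s', τ s s' ∧ s' ∈ X}

/-- Iterated pre-image: `PreIter τ 0 X = X` and `PreIter τ (n+1) X = Pre τ (PreIter τ n X)`. -/
def PreIter {S : Type*} (τ : S → S → Prop) : ℕ → Set S → Set S
  | 0, X => X
  | n + 1, X => Pre τ (PreIter τ n X)

/-- If backward reachability reaches a fix-point at stage `k` without meeting the initial
states, then the complement of the set `B` of backward reachable states is a safety
invariant: it contains the initial states, is closed under transitions, and is disjoint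
from the unsafe states. -/
theorem breach_fixpoint_gives_invariant {S : Type*} (τ : S → S → Prop) (I U : Set S)
    (k : ℕ) (B : Set S) (hB : B = ⋃ i ≤ k, PreIter τ i U)
    (hfix : PreIter τ (k + 1) U ⊆ B)
    (hsafe : ∀ i ≤ k, I ∩ PreIter τ i U = ∅) :
    I ⊆ Bᶜ ∧ (∀ s s' : S, s ∈ Bᶜ → τ s s' → s' ∈ Bᶜ) ∧ Bᶜ ∩ U = ∅ := by
  have mem : ∀ s, s ∈ B ↔ ∃ i, i ≤ k ∧ s ∈ PreIter τ i U := by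
    intro s
    rw [hB]
    simp only [Set.mem_iUnion, exists_prop]
  refine ⟨?_, ?_, ?_⟩
  · intro s hs hsB
    obtain ⟨i, hi, hsi⟩ := (mem s).1 hsB
    have h : s ∈ I ∩ PreIter τ i U := ⟨hs, hsi⟩
    rw [hsafe i hi] at h
    exact h
  · intro s s' hs hst hs'
    obtain ⟨i, hi, hsi⟩ := (mem s').1 hs'
    have h : s ∈ PreIter τ (i + 1) U := ⟨s', hst, hsi⟩
    apply hs
    rcases Nat.lt_or_eq_of_le hi with hlt | heq
    · exact (mem s).2 ⟨i + 1, hlt, h⟩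
    · rw [heq] at h
      exact hfix h
  · apply Set.eq_empty_of_forall_notMem
    rintro s ⟨hs, hU⟩
    exact hs ((mem s).2 ⟨0, Nat.zero_le k, hU⟩)
end

section
/- (Soundness of backward reachability with invariants.) Consider a transition system with states S, transition relation τ, initial states I, and unsafe states U. Let H₁, …, H_m ⊆ S be such that for each j: I ∩ H_j = ∅ and for all s, s', if s ∉ H_j and τ s s' then s' ∉ H_j (i.e., each complement S \ H_j is an invariant containing I). Fix k ∈ ℕ and let B = ⋃_{i=0}^{k} Pre^i(U) ∪ ⋃_{j=1}^{m} H_j. If Pre^{k+1}(U) ⊆ B and I ∩ Pre^i(U) = ∅ for every i ≤ k, then the system is safe: for every n there is no run of length n from I to U. -/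
/-- Soundness of backward reachability with invariants: if each `H j` is disjoint from `I`
and its complement is closed under transitions, and the `(k+1)`-st pre-image of `U` is
contained in the union `B` of the first `k+1` pre-images together with the `H j`'s, while
no pre-image up to stage `k` meets `I`, then the system is safe. -/
theorem breach_with_invariants_sound {S : Type*} (τ : S → S → Prop) (I U : Set S)
    {m : ℕ} (H : Fin m → Set S)
    (hH1 : ∀ j, I ∩ H j = ∅)
    (hH2 : ∀ (j) (s s' : S), s ∉ H j → τ s s' → s' ∉ H j)
    (k : ℕ)
    (hfix : PreIter τ (k + 1) U ⊆ (⋃ i ≤ k, PreIter τ i U) ∪ ⋃ j, H j)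
    (hsafe : ∀ i ≤ k, I ∩ PreIter τ i U = ∅) :
    ∀ (n : ℕ) (seq : ℕ → S), seq 0 ∈ I → (∀ i < n, τ (seq i) (seq (i + 1))) →
      seq n ∉ U := by
  intro n seq h0 hstep hU
  have hinv : ∀ j, ∀ i ≤ n, seq i ∉ H j := by
    intro j i
    induction i with
    | zero =>
      intro _ hj
      have : seq 0 ∈ I ∩ H j := ⟨h0, hj⟩
      rw [hH1 j] at this
      exact this
    | succ i ih =>
      intro hi
      exact hH2 j _ _ (ih (by omega)) (hstep i (by omega))
  have hback : ∀ d e, e + d = n → ∃ i ≤ k, seq e ∈ PreIter τ i U := by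
    intro d
    induction d with
    | zero =>
      intro e he
      obtain rfl : e = n := by omega
      exact ⟨0, Nat.zero_le _, hU⟩
    | succ d ih =>
      intro e he
      obtain ⟨i, hi, hm⟩ := ih (e + 1) (by omega)
      have hp : seq e ∈ PreIter τ (i + 1) U := ⟨seq (e + 1), hstep e (by omega), hm⟩
      rcases Nat.lt_or_ge i k with h | h
      · exact ⟨i + 1, h, hp⟩
      · obtain rfl : i = k := by omega
        rcases hfix hp with h | h
        · simp only [Set.mem_iUnion] at h
          obtain ⟨i', hi', h⟩ := h
          exact ⟨i', hi', h⟩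
        · obtain ⟨j, hj⟩ := Set.mem_iUnion.1 h
          exact absurd hj (hinv j e (by omega))
  obtain ⟨i, hi, hm⟩ := hback n 0 (by omega)
  have : seq 0 ∈ I ∩ PreIter τ i U := ⟨h0, hm⟩
  rw [hsafe i hi] at this
  exact this
end
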